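/- For every w, u ∈ ℝ^d, F(u) − F(w) − ⟪∇F(w), u − w⟫ ≤ (L(w)/2) · ‖u − w‖², where L(w) = 4L + 2ρα ∑_{i∈I} p_i ‖∇f_i(w)‖. -/

import Mathlib

open scoped RealInnerProductSpace BigOperators

section Descent

variable {E : Type*} [NormedAddCommGroup E]

/-- The descent inequality at a point `w`, assuming the Lipschitz bound on the derivative only for
pairs of points that include `w`. -/
theorem sub_sub_fderiv_le_of_norm_fderiv_sub_le [NormedSpace ℝ E] {G : E → ℝ} {G' : E → E →L[ℝ] ℝ}
    (hG : ∀ v, HasFDerivAt G (G' v) v) {w : E} {K : ℝ}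
    (hK : ∀ v, ‖G' v - G' w‖ ≤ K * ‖v - w‖) (u : E) :
    G u - G w - G' w (u - w) ≤ K / 2 * ‖u - w‖ ^ 2 := by
  set x := u - w with hx
  let φ : ℝ → ℝ := fun t ↦ G (w + t • x) - t * G' w x - K / 2 * ‖x‖ ^ 2 * t ^ 2
  have hφ (t : ℝ) : HasDerivAt φ (G' (w + t • x) x - G' w x - K * ‖x‖ ^ 2 * t) t := by
    have hline : HasDerivAt (fun t : ℝ ↦ w + t • x) x t := by
      simpa using ((hasDerivAt_id t).smul_const x).const_add w
    have h1 := (hG (w + t • x)).comp_hasDerivAt t hline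
    have h2 := (hasDerivAt_id t).mul_const (G' w x)
    have h3 := ((hasDerivAt_id t).pow 2).const_mul (K / 2 * ‖x‖ ^ 2)
    refine ((h1.sub h2).sub h3).congr_deriv ?_
    simp only [id, Nat.cast_ofNat]
    ring
  have hanti : AntitoneOn φ (Set.Icc 0 1) := by
    refine antitoneOn_of_hasDerivWithinAt_nonpos (convex_Icc 0 1)
      (fun t _ ↦ (hφ t).continuousAt.continuousWithinAt)
      (fun t _ ↦ (hφ t).hasDerivWithinAt) fun t ht ↦ ?_
    rw [interior_Icc] at ht
    have h1 : (G' (w + t • x) - G' w) x ≤ K * ‖t • x‖ * ‖x‖ :=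
      (le_abs_self _).trans <| ((G' (w + t • x) - G' w).le_opNorm x).trans <|
        mul_le_mul_of_nonneg_right (by simpa using hK (w + t • x)) (norm_nonneg x)
    rw [norm_smul, Real.norm_of_nonneg ht.1.le, sub_apply] at h1
    linarith
  have h := hanti (Set.left_mem_Icc.2 zero_le_one) (Set.right_mem_Icc.2 zero_le_one) zero_le_one
  simp only [φ, one_smul, zero_smul, add_zero, hx, add_sub_cancel] at h
  linarith

variable [InnerProductSpace ℝ E] [CompleteSpace E]

theorem ContDiff.differentiable_gradient {f : E → ℝ} (hf : ContDiff ℝ 2 f) :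
    Differentiable ℝ (gradient f) :=
  (InnerProductSpace.toDual ℝ E).symm.differentiable.comp
    ((hf.fderiv_right (m := 1) (by norm_num)).differentiable (by norm_num))

theorem norm_fderiv_eq_norm_gradient (f : E → ℝ) (v : E) : ‖fderiv ℝ f v‖ = ‖gradient f v‖ := by
  simp [gradient]

theorem norm_fderiv_sub_fderiv_eq (f : E → ℝ) (v w : E) :
    ‖fderiv ℝ f v - fderiv ℝ f w‖ = ‖gradient f v - gradient f w‖ := by
  rw [gradient, gradient, ← map_sub, LinearIsometryEquiv.norm_map]

/-- The derivative of `w ↦ f (w - α • gradient f w)`. -/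
noncomputable def gradientStepFDeriv (f : E → ℝ) (α : ℝ) (w : E) : E →L[ℝ] ℝ :=
  (fderiv ℝ f (w - α • gradient f w)).comp
    (ContinuousLinearMap.id ℝ E - α • fderiv ℝ (gradient f) w)

theorem hasFDerivAt_gradientStep {f : E → ℝ} (hf : ContDiff ℝ 2 f) (α : ℝ) (w : E) :
    HasFDerivAt (fun v ↦ f (v - α • gradient f v)) (gradientStepFDeriv f α w) w := by
  have hstep : HasFDerivAt (fun v ↦ v - α • gradient f v)
      (ContinuousLinearMap.id ℝ E - α • fderiv ℝ (gradient f) w) w :=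
    (hasFDerivAt_id w).sub ((hf.differentiable_gradient w).hasFDerivAt.const_smul α)
  exact ((hf.differentiable (by norm_num)) _).hasFDerivAt.comp w hstep

theorem norm_gradientStepFDeriv_sub_le {f : E → ℝ} {L ρ α : ℝ} (hL : 0 ≤ L)
    (hα0 : 0 ≤ α) (hαL : α * L ≤ 1)
    (hgrad : ∀ w u, ‖gradient f w - gradient f u‖ ≤ L * ‖w - u‖)
    (hhess : ∀ w u, ‖fderiv ℝ (gradient f) w - fderiv ℝ (gradient f) u‖ ≤ ρ * ‖w - u‖)
    (v w : E) :
    ‖gradientStepFDeriv f α v - gradientStepFDeriv f α w‖ ≤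
      (4 * L + 2 * ρ * α * ‖gradient f w‖) * ‖v - w‖ := by
  set H := fderiv ℝ (gradient f)
  set T : E → E := fun v ↦ v - α • gradient f v
  have hH : ‖H v‖ ≤ L :=
    norm_fderiv_le_of_lipschitz ℝ (C := ⟨L, hL⟩)
      (LipschitzWith.of_dist_le_mul fun x y ↦ by
        rw [dist_eq_norm, dist_eq_norm]; exact hgrad x y)
  have hA : ‖ContinuousLinearMap.id ℝ E - α • H v‖ ≤ 2 := by
    refine (norm_sub_le _ _).trans ?_
    rw [norm_smul, Real.norm_of_nonneg hα0]
    linarith [ContinuousLinearMap.norm_id_le (𝕜 := ℝ) (E := E), mul_le_mul_of_nonneg_left hH hα0]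
  have hT : ‖T v - T w‖ ≤ 2 * ‖v - w‖ := by
    have h : T v - T w = (v - w) - α • (gradient f v - gradient f w) := by
      simp only [T, smul_sub]; abel
    rw [h]
    refine (norm_sub_le _ _).trans ?_
    rw [norm_smul, Real.norm_of_nonneg hα0]
    linarith [mul_le_mul_of_nonneg_left (hgrad v w) hα0,
      mul_le_mul_of_nonneg_right hαL (norm_nonneg (v - w))]
  have hg : ‖gradient f (T w)‖ ≤ 2 * ‖gradient f w‖ := by
    have h1 : ‖T w - w‖ = α * ‖gradient f w‖ := by
      simp [T, norm_smul, abs_of_nonneg hα0]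
    have h2 := hgrad (T w) w
    rw [h1] at h2
    linarith [norm_le_norm_add_norm_sub' (gradient f (T w)) (gradient f w),
      mul_le_mul_of_nonneg_right hαL (norm_nonneg (gradient f w))]
  have hsplit : gradientStepFDeriv f α v - gradientStepFDeriv f α w =
      (fderiv ℝ f (T v) - fderiv ℝ f (T w)).comp (ContinuousLinearMap.id ℝ E - α • H v) -
        α • (fderiv ℝ f (T w)).comp (H v - H w) := by
    ext x
    simp [gradientStepFDeriv, H, T]
    ring
  have h1 : ‖(fderiv ℝ f (T v) - fderiv ℝ f (T w)).comp (ContinuousLinearMap.id ℝ E - α • H v)‖ ≤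
      L * (2 * ‖v - w‖) * 2 := by
    refine (ContinuousLinearMap.opNorm_comp_le _ _).trans ?_
    rw [norm_fderiv_sub_fderiv_eq]
    have := (hgrad (T v) (T w)).trans (mul_le_mul_of_nonneg_left hT hL)
    gcongr
  have h2 : ‖(fderiv ℝ f (T w)).comp (H v - H w)‖ ≤
      2 * ‖gradient f w‖ * (ρ * ‖v - w‖) := by
    refine (ContinuousLinearMap.opNorm_comp_le _ _).trans ?_
    rw [norm_fderiv_eq_norm_gradient]
    exact mul_le_mul hg (hhess v w) (norm_nonneg _) (by positivity)
  rw [hsplit]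
  refine (norm_sub_le _ _).trans ?_
  rw [norm_smul, Real.norm_of_nonneg hα0]
  linarith [mul_le_mul_of_nonneg_left h2 hα0]

end Descent

/-- **Descent inequality for the MAML objective** (Corollary `bergman_bound`).
For every `w, u ∈ ℝ^d`, `F(u) − F(w) − ⟪∇F(w), u − w⟫ ≤ (L(w)/2) ‖u − w‖²`,
where `L(w) = 4L + 2ρα ∑_{i∈I} p_i ‖∇f_i(w)‖`. -/
theorem maml_descent_quadratic_bound
    {d : ℕ} {ι : Type*} [Fintype ι]
    (p : ι → ℝ) (hp : ∀ i, 0 ≤ p i) (hpsum : ∑ i, p i = 1)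
    (f : ι → EuclideanSpace ℝ (Fin d) → ℝ)
    (L ρ α : ℝ) (hL : 0 < L) (hρ : 0 < ρ) (hα0 : 0 ≤ α) (hα : α ≤ 1 / L)
    (hf : ∀ i, ContDiff ℝ 2 (f i))
    (hgrad : ∀ i w u, ‖gradient (f i) w - gradient (f i) u‖ ≤ L * ‖w - u‖)
    (hhess : ∀ i w u,
      ‖fderiv ℝ (gradient (f i)) w - fderiv ℝ (gradient (f i)) u‖ ≤ ρ * ‖w - u‖)
    (F : EuclideanSpace ℝ (Fin d) → ℝ)
    (hF : ∀ w, F w = ∑ i, p i * f i (w - α • gradient (f i) w))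
    (Lw : EuclideanSpace ℝ (Fin d) → ℝ)
    (hLw : ∀ w, Lw w = 4 * L + 2 * ρ * α * ∑ i, p i * ‖gradient (f i) w‖) :
    ∀ w u, F u - F w - ⟪gradient F w, u - w⟫ ≤ Lw w / 2 * ‖u - w‖ ^ 2 := by
  intro w u
  have hαL : α * L ≤ 1 := (le_div_iff₀ hL).1 hα
  let F' : EuclideanSpace ℝ (Fin d) → EuclideanSpace ℝ (Fin d) →L[ℝ] ℝ :=
    fun v ↦ ∑ i, p i • gradientStepFDeriv (f i) α v
  have hF' (v) : HasFDerivAt F (F' v) v := by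
    rw [funext hF]
    exact HasFDerivAt.fun_sum fun i _ ↦ (hasFDerivAt_gradientStep (hf i) α v).const_mul (p i)
  have hbound (v) : ‖F' v - F' w‖ ≤ Lw w * ‖v - w‖ := by
    calc ‖F' v - F' w‖
        = ‖∑ i, p i • (gradientStepFDeriv (f i) α v - gradientStepFDeriv (f i) α w)‖ := by
          simp only [F', smul_sub, Finset.sum_sub_distrib]
      _ ≤ ∑ i, p i * ((4 * L + 2 * ρ * α * ‖gradient (f i) w‖) * ‖v - w‖) := by
          refine norm_sum_le_of_le _ fun i _ ↦ ?_
          rw [norm_smul, Real.norm_of_nonneg (hp i)]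
          exact mul_le_mul_of_nonneg_left
            (norm_gradientStepFDeriv_sub_le hL.le hα0 hαL (hgrad i) (hhess i) v w) (hp i)
      _ = ((∑ i, p i) * (4 * L) + 2 * ρ * α * ∑ i, p i * ‖gradient (f i) w‖) * ‖v - w‖ := by
          rw [Finset.sum_mul, Finset.mul_sum, ← Finset.sum_add_distrib, Finset.sum_mul]
          exact Finset.sum_congr rfl fun i _ ↦ by ring
      _ = Lw w * ‖v - w‖ := by rw [hpsum, hLw, one_mul]
  have hinner : ⟪gradient F w, u - w⟫ = F' w (u - w) := by
    rw [gradient, InnerProductSpace.toDual_symm_apply, (hF' w).fderiv]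
  rw [hinner]
  exact sub_sub_fderiv_le_of_norm_fderiv_sub_le hF' hbound u
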